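/- Fix an integer k > 2, positive constants δ_1, ..., δ_k with δ_1 + ... + δ_k = 1, a constant c > 1, and weights w_1 > w_2 > ... > w_k > 0 with w_i ≥ 2·w_{i+1} for every 1 ≤ i ≤ k-1. Suppose m = m(n) satisfies m - n ≥ m/c for all n and m/n^{4/3} → 0 as n → ∞. Then the probability that a random instance of the complete and strict k-weighted popular matching problem with n applicants (|A_i| = δ_i·n for each i) and m items has a k-weighted popular matching tends to 0 as n → ∞ (along those n for which every δ_i·n is an integer). -/

import Mathlib

open scoped Classical
open Finset

noncomputable section

/-- An instance of the complete and strict k-weighted popular matching problem: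
applicants `A`, each with a category `cat x : Fin k`, strictly decreasing positive
weights `w`, items `I` with `|A| < |I|`, and for each applicant a strict complete
preference list encoded by an injective ranking function (smaller = more preferred). -/
structure KWPM (k : ℕ) (A I : Type) [Fintype A] [Fintype I] where
  cat : A → Fin k
  w : Fin k → ℝ
  w_pos : ∀ i, 0 < w i
  w_anti : StrictAnti w
  rank : A → I → ℕ
  rank_inj : ∀ x : A, Function.Injective (rank x)
  card_lt : Fintype.card A < Fintype.card I

namespace KWPM

variable {k : ℕ} {A I : Type} [Fintype A] [Fintype I] (P : KWPM k A I)

/-- applicant `x` prefers item `p` to item `q`. -/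
def Prefers (x : A) (p q : I) : Prop := P.rank x p < P.rank x q

/-- `M` is more popular than `M'`. -/
def MorePopular (M M' : A → I) : Prop :=
  (∑ x : A, if P.Prefers x (M' x) (M x) then P.w (P.cat x) else 0) <
    ∑ x : A, if P.Prefers x (M x) (M' x) then P.w (P.cat x) else 0

/-- `M` is a k-weighted popular matching. -/
def IsPopular (M : A → I) : Prop :=
  Function.Injective M ∧ ∀ M' : A → I, Function.Injective M' → ¬ P.MorePopular M' M

/-- the instance has a k-weighted popular matching. -/
def HasPopular : Prop := ∃ M : A → I, P.IsPopular M

end KWPM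

/-- The instance of the complete and strict k-weighted popular matching problem whose
`i`-th category consists of `sz i` applicants, with `m` items and weights `w`,
determined by a profile `σ` of preference rankings. -/
def kInstOf (K : ℕ) (sz : Fin K → ℕ) (m : ℕ) (w : Fin K → ℝ)
    (h : (∑ i, sz i) < m ∧ StrictAnti w ∧ ∀ i, 0 < w i)
    (σ : ((i : Fin K) × Fin (sz i)) → (Fin m ≃ Fin m)) :
    KWPM K ((i : Fin K) × Fin (sz i)) (Fin m) where
  cat := fun a => a.1
  w := w
  w_pos := h.2.2
  w_anti := h.2.1
  rank := fun a i => (σ a i : ℕ)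
  rank_inj := fun a p q hpq => (σ a).injective (Fin.val_injective hpq)
  card_lt := by simpa [Fintype.card_sigma] using h.1

/-- the probability that a uniformly random instance of the complete and strict
k-weighted popular matching problem with category sizes `sz`, `m` items and weights `w`
has a k-weighted popular matching. -/
def kmProb (K : ℕ) (sz : Fin K → ℕ) (m : ℕ) (w : Fin K → ℝ) : ℝ :=
  if h : (∑ i, sz i) < m ∧ StrictAnti w ∧ ∀ i, 0 < w i then
    ((Finset.univ.filter fun σ : ((i : Fin K) × Fin (sz i)) → (Fin m ≃ Fin m) =>
        (kInstOf K sz m w h σ).HasPopular).card : ℝ) /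
      (Fintype.card (((i : Fin K) × Fin (sz i)) → (Fin m ≃ Fin m)) : ℝ)
  else 0

namespace KWPM

variable {k : ℕ} {A I : Type} [Fintype A] [Fintype I]

lemma MorePopular.of_bounds {P : KWPM k A I} {M M' : A → I} (S : Finset A) (W : ℝ) (hW : 0 ≤ W)
    (hS : ∀ x ∈ S, P.Prefers x (M' x) (M x))
    (huniq : ∀ x y, P.Prefers x (M x) (M' x) → P.Prefers y (M y) (M' y) → x = y)
    (hle : ∀ x, P.Prefers x (M x) (M' x) → P.w (P.cat x) ≤ W)
    (hlt : W < ∑ x ∈ S, P.w (P.cat x)) : P.MorePopular M' M := by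
  unfold MorePopular
  have hgain : ∑ x ∈ S, P.w (P.cat x) ≤
      ∑ x : A, if P.Prefers x (M' x) (M x) then P.w (P.cat x) else 0 := by
    rw [← Finset.sum_filter]
    refine Finset.sum_le_sum_of_subset_of_nonneg (fun x hx => by simp [hS x hx]) ?_
    intro x _ _
    exact (P.w_pos _).le
  have hloss : (∑ x : A, if P.Prefers x (M x) (M' x) then P.w (P.cat x) else 0) ≤ W := by
    by_cases h : ∃ x, P.Prefers x (M x) (M' x)
    · obtain ⟨x, hx⟩ := h
      rw [Finset.sum_eq_single x]
      · simpa [hx] using hle x hx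
      · intro y _ hy
        rw [if_neg]
        exact fun h => hy (huniq y x h hx)
      · simp
    · push Not at h
      simpa [h] using hW
  linarith

lemma exists_unmatched (P : KWPM k A I) (M : A → I) : ∃ u, ∀ a, M a ≠ u := by
  by_contra! h
  exact absurd (Fintype.card_le_of_surjective M h) (not_le.mpr P.card_lt)

lemma not_prefers_self (P : KWPM k A I) (x : A) (p : I) : ¬ P.Prefers x p p := lt_irrefl _

lemma Prefers.asymm {P : KWPM k A I} {x : A} {p q : I} (h : P.Prefers x p q) :
    ¬ P.Prefers x q p := lt_asymm h

/-- In a popular matching, the first choice of some applicant that is no first choice of category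
`i₀` (the heaviest one) is held by an applicant outside category `i₀`. -/
lemma IsPopular.exists_holder {P : KWPM k A I} {M : A → I} (hM : P.IsPopular M) {i₀ : Fin k}
    (hi₀ : ∀ i, P.w i ≤ P.w i₀) {top : A → I}
    (htop : ∀ a q, q ≠ top a → P.Prefers a (top a) q) (y : A)
    (hy : ∀ a, P.cat a = i₀ → top a ≠ top y) :
    ∃ z, M z = top y ∧ P.cat z ≠ i₀ := by
  obtain ⟨hinj, hpop⟩ := hM
  by_contra! hcon
  by_cases hz : ∃ z, M z = top y
  · obtain ⟨z, hz⟩ := hz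
    have hzc := hcon z hz
    have hzy : z ≠ y := fun h => hy z hzc (by rw [h])
    obtain ⟨u, hu⟩ := P.exists_unmatched M
    have hne := hy z hzc
    let M' : A → I := fun a =>
      if a = y then top y else if a = z then top z else if M a = top z then u else M a
    have hy' : M' y = top y := by simp [M']
    have hz' : M' z = top z := by simp [M', hzy]
    have ho : ∀ a, a ≠ y → a ≠ z → M' a = if M a = top z then u else M a := by
      intro a h1 h2; simp [M', h1, h2]
    have hinj' : Function.Injective M' := by
      intro a b hab
      have hu' := hu
      by_contra hne'
      have hMne : M a ≠ M b := fun h => hne' (hinj h)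
      have key : ∀ a, a ≠ z → M a ≠ top y := fun a ha h => ha (hinj (h.trans hz.symm))
      have := hu z; have := hu a; have := hu b; have := key a; have := key b
      simp only [M'] at hab
      split_ifs at hab <;> grind
    refine hpop M' hinj' (MorePopular.of_bounds {y, z} (P.w i₀) (P.w_pos _).le ?_ ?_
      (fun x _ => hi₀ _) ?_)
    · intro x hx
      rcases Finset.mem_insert.mp hx with rfl | hx
      · rw [hy']; exact htop _ _ fun h => hzy (hinj (hz.trans h.symm))
      · rw [Finset.mem_singleton.mp hx, hz']
        exact htop _ _ (by rw [hz]; exact hne.symm)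
    · have : ∀ x, P.Prefers x (M x) (M' x) → M x = top z := by
        intro x hx
        by_cases h1 : x = y
        · subst h1
          rw [hy'] at hx
          by_cases h : M x = top x
          · rw [h] at hx; exact absurd hx (P.not_prefers_self _ _)
          · exact absurd hx (htop _ _ h).asymm
        by_cases h2 : x = z
        · subst h2
          rw [hz'] at hx
          by_cases h : M x = top x
          · exact h
          · exact absurd hx (htop _ _ h).asymm
        rw [ho x h1 h2] at hx
        by_contra h
        rw [if_neg h] at hx
        exact P.not_prefers_self _ _ hx
      exact fun x x' h h' => hinj ((this x h).trans (this x' h').symm)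
    · rw [Finset.sum_pair hzy.symm, hzc]
      linarith [P.w_pos (P.cat y)]
  · push Not at hz
    have hinj' : Function.Injective (Function.update M y (top y)) := by
      intro a b hab
      by_contra hne'
      have hMne : M a ≠ M b := fun h => hne' (hinj h)
      have := hz a; have := hz b
      simp only [Function.update_apply] at hab
      split_ifs at hab <;> grind
    have hno : ∀ x, ¬ P.Prefers x (M x) (Function.update M y (top y) x) := by
      intro x hx
      by_cases h : x = y
      · subst h
        simp only [Function.update_self] at hx
        exact (htop _ _ (hz x)).asymm hx
      · rw [Function.update_of_ne h] at hx
        exact P.not_prefers_self _ _ hx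
    refine hpop _ hinj' (MorePopular.of_bounds {y} 0 le_rfl ?_ (fun x _ h => absurd h (hno x))
      (fun x h => absurd h (hno x)) (by simpa using P.w_pos _))
    intro x hx
    rw [Finset.mem_singleton.mp hx]
    simpa using htop y _ (hz y)

lemma IsPopular.eq_top {P : KWPM k A I} {M : A → I} (hM : P.IsPopular M) {i₀ : Fin k}
    (hi₀ : ∀ i, i ≠ i₀ → P.w i < P.w i₀) {top sec : A → I}
    (htop : ∀ a q, q ≠ top a → P.Prefers a (top a) q)
    (hsec : ∀ a q, q ≠ top a → q ≠ sec a → P.Prefers a (sec a) q)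
    {x y : A} (hx : P.cat x = i₀) (hxy : sec x = top y)
    (hy : ∀ a, P.cat a = i₀ → top a ≠ top y) : M x = top x := by
  have hi₀' : ∀ i, P.w i ≤ P.w i₀ := fun i => by
    by_cases h : i = i₀
    · rw [h]
    · exact (hi₀ i h).le
  obtain ⟨z, hz, hzc⟩ := hM.exists_holder hi₀' htop y hy
  obtain ⟨hinj, hpop⟩ := hM
  by_contra hne
  have hzx : z ≠ x := fun h => hzc (h ▸ hx)
  have hxq : M x ≠ sec x := fun h => hzx (hinj (by rw [hz, h, hxy]))
  obtain ⟨u, hu⟩ := P.exists_unmatched M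
  let M' : A → I := fun a => if a = x then top y else if a = z then u else M a
  have hx' : M' x = top y := by simp [M']
  have hinj' : Function.Injective M' := by
    intro a b hab
    by_contra hne'
    have hMne : M a ≠ M b := fun h => hne' (hinj h)
    have key : ∀ a, a ≠ z → M a ≠ top y := fun a ha h => ha (hinj (h.trans hz.symm))
    have := hu z; have := hu a; have := hu b; have := key a; have := key b
    simp only [M'] at hab
    split_ifs at hab <;> grind
  have hpx : P.Prefers x (M' x) (M x) := by
    rw [hx', ← hxy]; exact hsec _ _ hne hxq
  have hlose : ∀ a, P.Prefers a (M a) (M' a) → a = z := by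
    intro a ha
    by_contra haz
    by_cases hax : a = x
    · subst hax; exact hpx.asymm ha
    · have : M' a = M a := by simp [M', hax, haz]
      rw [this] at ha
      exact P.not_prefers_self _ _ ha
  refine hpop M' hinj' (MorePopular.of_bounds {x} (P.w (P.cat z)) (P.w_pos _).le ?_
    (fun a b ha hb => (hlose a ha).trans (hlose b hb).symm)
    (fun a ha => by rw [hlose a ha]) (by simpa [hx] using hi₀ _ hzc))
  intro a ha
  rw [Finset.mem_singleton.mp ha]
  exact hpx

lemma not_hasPopular_of_conflict {P : KWPM k A I} {i₀ : Fin k}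
    (hi₀ : ∀ i, i ≠ i₀ → P.w i < P.w i₀) {top sec : A → I}
    (htop : ∀ a q, q ≠ top a → P.Prefers a (top a) q)
    (hsec : ∀ a q, q ≠ top a → q ≠ sec a → P.Prefers a (sec a) q)
    {x₁ x₂ y₁ y₂ : A} (hne : x₁ ≠ x₂) (hx₁ : P.cat x₁ = i₀) (hx₂ : P.cat x₂ = i₀)
    (hx : top x₁ = top x₂) (h₁ : sec x₁ = top y₁) (h₂ : sec x₂ = top y₂)
    (hy₁ : ∀ a, P.cat a = i₀ → top a ≠ top y₁) (hy₂ : ∀ a, P.cat a = i₀ → top a ≠ top y₂) :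
    ¬ P.HasPopular := by
  rintro ⟨M, hM⟩
  refine hne (hM.1 ?_)
  rw [hM.eq_top hi₀ htop hsec hx₁ h₁ hy₁, hM.eq_top hi₀ htop hsec hx₂ h₂ hy₂, hx]

end KWPM

/-- Chebyshev's inequality for a sum of equiprobable, pairwise nonpositively correlated
indicators under the uniform distribution on `Ω`. -/
lemma card_filter_few_events_mul_le {α ι : Type*} (Ω : Finset α) (D : Finset ι)
    (E : ι → α → Prop) (x : ℝ) (hx : 0 ≤ x)
    (h₁ : ∀ p ∈ D, (#{ω ∈ Ω | E p ω} : ℝ) = x * #Ω)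
    (h₂ : ∀ p ∈ D, ∀ q ∈ D, p ≠ q → (#{ω ∈ Ω | E p ω ∧ E q ω} : ℝ) ≤ x ^ 2 * #Ω) :
    (#{ω ∈ Ω | 2 * (#{p ∈ D | E p ω} : ℝ) < #D * x} : ℝ) * (#D * x) ≤ 4 * #Ω := by
  set d : ℝ := (#D : ℝ) with hd
  set T : ℝ := (#Ω : ℝ) with hT
  have hd0 : 0 ≤ d := by positivity
  have hT0 : 0 ≤ T := by positivity
  let Z : α → ℝ := fun ω => ∑ p ∈ D, if E p ω then 1 else 0
  have hZ : ∀ ω, (#{p ∈ D | E p ω} : ℝ) = Z ω := fun ω => by simp [Z]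
  simp only [hZ]
  have hmean : ∑ ω ∈ Ω, Z ω = d * x * T := by
    simp only [Z]
    rw [Finset.sum_comm]
    have : ∀ p ∈ D, (∑ ω ∈ Ω, if E p ω then (1 : ℝ) else 0) = x * T := by
      intro p hp
      rw [← h₁ p hp]; simp
    rw [Finset.sum_congr rfl this]
    simp [← hd]; ring
  have hsq : ∑ ω ∈ Ω, Z ω ^ 2 ≤ d ^ 2 * x ^ 2 * T + d * x * T := by
    have : ∑ ω ∈ Ω, Z ω ^ 2 = ∑ p ∈ D, ∑ q ∈ D, (#{ω ∈ Ω | E p ω ∧ E q ω} : ℝ) := by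
      simp only [Z, pow_two, Finset.sum_mul_sum]
      rw [Finset.sum_comm]
      refine Finset.sum_congr rfl fun p _ => ?_
      rw [Finset.sum_comm]
      refine Finset.sum_congr rfl fun q _ => ?_
      rw [Finset.card_filter]
      push_cast
      refine Finset.sum_congr rfl fun ω _ => ?_
      by_cases h : E p ω <;> by_cases h' : E q ω <;> simp [h, h']
    rw [this]
    calc _ ≤ ∑ p ∈ D, ∑ q ∈ D, (x ^ 2 * T + if p = q then x * T else 0) := by
          refine Finset.sum_le_sum fun p hp => Finset.sum_le_sum fun q hq => ?_
          by_cases h : p = q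
          · subst h
            simp only [and_self, if_true, h₁ p hp]
            nlinarith [mul_nonneg (sq_nonneg x) hT0]
          · simpa [h] using h₂ p hp q hq h
      _ = _ := by
          simp only [Finset.sum_add_distrib, Finset.sum_const, Finset.sum_ite_eq, nsmul_eq_mul]
          rw [Finset.sum_congr rfl (g := fun _ => x * T) (fun p hp => by simp [hp])]
          simp only [Finset.sum_const, nsmul_eq_mul, ← hd]
          ring
  have hvar : ∑ ω ∈ Ω, (Z ω - d * x) ^ 2 ≤ d * x * T := by
    have : ∑ ω ∈ Ω, (Z ω - d * x) ^ 2 =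
        ∑ ω ∈ Ω, Z ω ^ 2 - 2 * (d * x) * ∑ ω ∈ Ω, Z ω + (d * x) ^ 2 * T := by
      rw [Finset.mul_sum, ← Finset.sum_sub_distrib]
      have hc : (d * x) ^ 2 * T = ∑ ω ∈ Ω, (d * x) ^ 2 := by simp [← hT]; ring
      rw [hc, ← Finset.sum_add_distrib]
      exact Finset.sum_congr rfl fun ω _ => by ring
    rw [this, hmean]
    nlinarith
  have hbad : (#{ω ∈ Ω | 2 * Z ω < d * x} : ℝ) * (d * x / 2) ^ 2 ≤ d * x * T := by
    refine le_trans ?_ hvar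
    calc (#{ω ∈ Ω | 2 * Z ω < d * x} : ℝ) * (d * x / 2) ^ 2
        = ∑ ω ∈ Ω with 2 * Z ω < d * x, (d * x / 2) ^ 2 := by simp
      _ ≤ ∑ ω ∈ Ω with 2 * Z ω < d * x, (Z ω - d * x) ^ 2 := by
          refine Finset.sum_le_sum fun ω hω => ?_
          have := (Finset.mem_filter.mp hω).2
          have : 0 ≤ d * x := by positivity
          nlinarith
      _ ≤ _ := Finset.sum_le_sum_of_subset_of_nonneg (Finset.filter_subset _ _)
          fun _ _ _ => sq_nonneg _
  rcases (mul_nonneg hd0 hx).eq_or_lt with h0 | h0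
  · rw [← h0]; simp; exact hT0
  · have : (d * x) * ((#{ω ∈ Ω | 2 * Z ω < d * x} : ℝ) * (d * x)) ≤ (d * x) * (4 * T) := by
      nlinarith
    exact le_of_mul_le_mul_left this h0

lemma card_filter_le_of_fiberwise {α κ : Type*} [Fintype α] (Φ : α → κ) (r : α → α → Prop)
    [DecidableRel r] (hr : ∀ σ τ, r σ τ ↔ Φ σ = Φ τ) (B : α → Prop) [DecidablePred B] (ε : ℝ)
    (h : ∀ τ, (#{σ | r σ τ ∧ B σ} : ℝ) ≤ ε * #{σ | r σ τ}) :
    (#{σ | B σ} : ℝ) ≤ ε * Fintype.card α := by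
  have e₂ := Finset.card_eq_sum_card_fiberwise (f := Φ) (s := (univ : Finset α))
    (t := univ.image Φ) (fun a _ => by simp)
  have e₃ := Finset.card_eq_sum_card_fiberwise (f := Φ) (s := univ.filter B)
    (t := univ.image Φ) (fun a _ => by simp)
  rw [← Finset.card_univ, e₂, e₃]
  push_cast
  rw [Finset.mul_sum]
  refine Finset.sum_le_sum fun b hb => ?_
  obtain ⟨τ, -, rfl⟩ := Finset.mem_image.mp hb
  have h₁ : #{σ ∈ univ.filter B | Φ σ = Φ τ} = #{σ | r σ τ ∧ B σ} := by
    congr 1; ext σ; simp [hr, and_comm]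
  have h₂ : #{σ | Φ σ = Φ τ} = #{σ | r σ τ} := by
    congr 1; ext σ; simp [hr]
  rw [h₁, h₂]
  exact h τ

lemma one_sub_inv_pow_le {m : ℝ} (hm : 1 ≤ m) (r : ℕ) (hr : (r : ℝ) ≤ m) :
    r / (2 * m) ≤ 1 - (1 - 1 / m) ^ r := by
  have hm0 : 0 < m := by linarith
  have h1 : 0 ≤ 1 - 1 / m := by
    rw [sub_nonneg, div_le_one hm0]; exact hm
  have hb : 1 + (r : ℝ) * (1 / m) ≤ (1 + 1 / m) ^ r :=
    one_add_mul_le_pow (by have : 0 ≤ 1 / m := by positivity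
                           linarith) r
  have hp : (1 - 1 / m) ^ r * (1 + 1 / m) ^ r ≤ 1 := by
    rw [← mul_pow]
    apply pow_le_one₀
    · apply mul_nonneg h1; positivity
    · nlinarith [sq_nonneg (1 / m)]
  set X := (1 - 1 / m) ^ r with hX
  have hX0 : 0 ≤ X := pow_nonneg h1 _
  set u := (r : ℝ) * (1 / m) with hu
  have hu0 : 0 ≤ u := by positivity
  have hu1 : u ≤ 1 := by rw [hu, mul_one_div, div_le_one hm0]; exact hr
  have : X * (1 + u) ≤ 1 := le_trans (mul_le_mul_of_nonneg_left hb hX0) hp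
  have e : (r : ℝ) / (2 * m) = u / 2 := by rw [hu]; field_simp
  rw [e]
  by_contra! hc
  nlinarith

section Sampling

variable {A β I : Type} [Fintype A] [Fintype β] [Fintype I] {top sec : β → I} {f : ℕ}

/-- Some member of `R` has first choice `p` under the profile `σ`. -/
def Hits (top : β → I) (R : Finset A) (σ : A → β) (p : I) : Prop := ∃ a ∈ R, top (σ a) = p

omit [Fintype I] in
lemma card_top_mem (htop : ∀ p, #{b | top b = p} = f) (S : Finset I) :
    #{b | top b ∈ S} = #S * f := by
  rw [Finset.card_eq_sum_card_fiberwise (f := top) (t := S) (fun a ha => by simpa using ha)]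
  rw [Finset.sum_congr rfl (g := fun _ => f), Finset.sum_const, smul_eq_mul]
  intro p hp
  rw [← htop p]
  congr 1
  ext b
  simp only [Finset.mem_filter, Finset.mem_univ, true_and, and_iff_right_iff_imp]
  rintro rfl; exact hp

lemma card_avoiding (htop : ∀ p, #{b | top b = p} = f) (R : Finset A) (τ : A → β)
    (S : Finset I) :
    #{σ : A → β | (∀ a ∉ R, σ a = τ a) ∧ ∀ a ∈ R, top (σ a) ∉ S} =
      ((Fintype.card I - #S) * f) ^ #R := by
  have : ({σ : A → β | (∀ a ∉ R, σ a = τ a) ∧ ∀ a ∈ R, top (σ a) ∉ S} : Finset (A → β)) =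
      Fintype.piFinset fun a => if a ∈ R then ({b | top b ∈ Sᶜ} : Finset β) else {τ a} := by
    ext σ
    simp only [Finset.mem_filter, Finset.mem_univ, true_and, Fintype.mem_piFinset]
    constructor
    · rintro ⟨h1, h2⟩ a
      by_cases h : a ∈ R
      · simpa [h] using h2 a h
      · simpa [h] using h1 a h
    · intro h
      refine ⟨fun a ha => by simpa [ha] using h a, fun a ha => by simpa [ha] using h a⟩
  rw [this, Fintype.card_piFinset]
  have h2 : ∀ a, #(if a ∈ R then ({b | top b ∈ Sᶜ} : Finset β) else {τ a}) =
      if a ∈ R then (Fintype.card I - #S) * f else 1 := by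
    intro a
    split_ifs
    · rw [card_top_mem htop, Finset.card_compl]
    · simp
  simp only [h2]
  simp

/-- With the choices outside `R` frozen, the first choices of `R` rarely hit few items of `D`. -/
lemma card_few_hits_fiber (htop : ∀ p, #{b | top b = p} = f) (R : Finset A) (τ : A → β)
    (D : Finset I) (hI : 0 < Fintype.card I) (hR : #R ≤ Fintype.card I) :
    (#{σ : A → β | (∀ a ∉ R, σ a = τ a) ∧
        4 * (Fintype.card I : ℝ) * #{p ∈ D | Hits top R σ p} < #D * #R} : ℝ) *
      (#D * #R) ≤ 8 * Fintype.card I * #{σ : A → β | ∀ a ∉ R, σ a = τ a} := by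
  set m := Fintype.card I with hm
  have hm0 : (0 : ℝ) < m := by exact_mod_cast hI
  have hm1 : (1 : ℝ) ≤ m := by exact_mod_cast hI
  let Ω : Finset (A → β) := {σ | ∀ a ∉ R, σ a = τ a}
  have hav : ∀ S : Finset I, (#{σ ∈ Ω | ∀ a ∈ R, top (σ a) ∉ S} : ℝ) =
      (1 - #S / m) ^ #R * #Ω := by
    intro S
    have h0 := card_avoiding htop R τ ∅
    have hS := card_avoiding htop R τ S
    have e0 : #Ω = (m * f) ^ #R := by simpa [Ω] using h0
    have hSm : #S ≤ m := Finset.card_le_univ S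
    simp only [Ω, Finset.filter_filter] at e0 ⊢
    rw [hS, e0]
    rw [← hm, Nat.cast_pow, Nat.cast_pow, ← mul_pow, Nat.cast_mul, Nat.cast_mul, Nat.cast_sub hSm]
    congr 1
    field_simp
  set x : ℝ := 1 - (1 - 1 / m) ^ #R with hx
  have hxr : (#R : ℝ) / (2 * m) ≤ x := one_sub_inv_pow_le hm1 _ (by exact_mod_cast hR)
  have hx0 : 0 ≤ x := le_trans (by positivity) hxr
  have hsplit : ∀ p, (#{σ ∈ Ω | Hits top R σ p} : ℝ) +
      #{σ ∈ Ω | ¬ Hits top R σ p} = #Ω := by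
    intro p
    have := Finset.card_filter_add_card_filter_not (s := Ω) (fun σ => Hits top R σ p)
    exact_mod_cast this
  have hone : ∀ p, (#{σ ∈ Ω | ¬ Hits top R σ p} : ℝ) = (1 - x) * #Ω := by
    intro p
    have := hav {p}
    rw [Finset.card_singleton, Nat.cast_one] at this
    have e : #{σ ∈ Ω | ¬ Hits top R σ p} = #{σ ∈ Ω | ∀ a ∈ R, top (σ a) ∉ ({p} : Finset I)} := by
      congr 1; ext σ; simp [Hits]
    rw [e, this, hx]; ring
  have key := card_filter_few_events_mul_le Ω D (fun p σ => Hits top R σ p) x hx0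
    (fun p _ => by linarith [hsplit p, hone p]) (by
      intro p _ q _ hpq
      have htwo : (#{σ ∈ Ω | ∀ a ∈ R, top (σ a) ∉ ({p, q} : Finset I)} : ℝ) ≤
          (1 - x) ^ 2 * #Ω := by
        rw [hav, Finset.card_pair hpq]
        refine mul_le_mul_of_nonneg_right ?_ (by positivity)
        have h2m : (2 : ℝ) ≤ m := by
          have : #({p, q} : Finset I) ≤ m := Finset.card_le_univ _
          rw [Finset.card_pair hpq] at this
          exact_mod_cast this
        have : (1 - x) ^ 2 = ((1 - 1 / (m : ℝ)) ^ 2) ^ #R := by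
          rw [hx, ← pow_mul, mul_comm, pow_mul]; ring
        rw [this]
        refine pow_le_pow_left₀ ?_ ?_ _
        · rw [sub_nonneg, div_le_one hm0]; exact_mod_cast h2m
        · have : ((2 : ℕ) : ℝ) / m = 2 * (1 / m) := by push_cast; ring
          rw [this]
          nlinarith [sq_nonneg (1 / (m : ℝ))]
      have hincl : #{σ ∈ Ω | Hits top R σ p ∧ Hits top R σ q} +
          #{σ ∈ Ω | ¬ Hits top R σ p} + #{σ ∈ Ω | ¬ Hits top R σ q} =
          #Ω + #{σ ∈ Ω | ∀ a ∈ R, top (σ a) ∉ ({p, q} : Finset I)} := by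
        have e : ({σ ∈ Ω | ∀ a ∈ R, top (σ a) ∉ ({p, q} : Finset I)} : Finset (A → β)) =
            {σ ∈ Ω | ¬ Hits top R σ p ∧ ¬ Hits top R σ q} := by
          ext σ; simp only [Hits, Finset.mem_filter, Finset.mem_insert, Finset.mem_singleton]; grind
        rw [e, Finset.card_eq_sum_ones Ω]
        simp only [Finset.card_filter]
        rw [← Finset.sum_add_distrib, ← Finset.sum_add_distrib, ← Finset.sum_add_distrib]
        refine Finset.sum_congr rfl fun σ _ => ?_
        by_cases h1 : Hits top R σ p <;> by_cases h2 : Hits top R σ q <;> simp [h1, h2]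
      have hincl' : (#{σ ∈ Ω | Hits top R σ p ∧ Hits top R σ q} : ℝ) +
          #{σ ∈ Ω | ¬ Hits top R σ p} + #{σ ∈ Ω | ¬ Hits top R σ q} =
          #Ω + #{σ ∈ Ω | ∀ a ∈ R, top (σ a) ∉ ({p, q} : Finset I)} := by exact_mod_cast hincl
      rw [hone p, hone q] at hincl'
      nlinarith)
  have hDR : (#D : ℝ) * #R ≤ 2 * m * (#D * x) := by
    have : (#R : ℝ) ≤ 2 * m * x := by
      rw [div_le_iff₀ (by positivity)] at hxr; linarith
    nlinarith [(Nat.cast_nonneg #D : (0 : ℝ) ≤ #D)]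
  have hmono : (#{σ : A → β | (∀ a ∉ R, σ a = τ a) ∧
        4 * (m : ℝ) * #{p ∈ D | Hits top R σ p} < #D * #R} : ℝ) ≤
      #{σ ∈ Ω | 2 * (#{p ∈ D | Hits top R σ p} : ℝ) < #D * x} := by
    have : #{σ : A → β | (∀ a ∉ R, σ a = τ a) ∧
        4 * (m : ℝ) * #{p ∈ D | Hits top R σ p} < #D * #R} ≤
      #{σ ∈ Ω | 2 * (#{p ∈ D | Hits top R σ p} : ℝ) < #D * x} := by
      refine Finset.card_le_card fun σ hσ => ?_
      simp only [Ω, Finset.mem_filter, Finset.mem_univ, true_and] at hσ ⊢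
      refine ⟨hσ.1, ?_⟩
      by_contra! hc
      nlinarith [hσ.2]
    exact_mod_cast this
  calc _ ≤ (#{σ ∈ Ω | 2 * (#{p ∈ D | Hits top R σ p} : ℝ) < #D * x} : ℝ) *
        (2 * m * (#D * x)) := by gcongr
    _ = 2 * m * ((#{σ ∈ Ω | 2 * (#{p ∈ D | Hits top R σ p} : ℝ) < #D * x} : ℝ) *
        (#D * x)) := by ring
    _ ≤ 2 * m * (4 * #Ω) := mul_le_mul_of_nonneg_left key (by positivity)
    _ = _ := by simp only [Ω]; ring

lemma card_few_hits (htop : ∀ p, #{b | top b = p} = f) (R : Finset A)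
    (D : (A → β) → Finset I) (hD : ∀ σ τ : A → β, (∀ a ∉ R, σ a = τ a) → D σ = D τ)
    (hI : 0 < Fintype.card I) (hR0 : 0 < #R) (hR : #R ≤ Fintype.card I) (d : ℝ) (hd : 0 < d) :
    (#{σ : A → β | d ≤ #(D σ) ∧
        4 * (Fintype.card I : ℝ) * #{p ∈ D σ | Hits top R σ p} < #(D σ) * #R} : ℝ) ≤
      8 * Fintype.card I / (d * #R) * Fintype.card (A → β) := by
  refine card_filter_le_of_fiberwise (fun (σ : A → β) (a : {a // a ∉ R}) => σ a)
    (fun σ τ => ∀ a ∉ R, σ a = τ a) (fun σ τ => by simp [funext_iff]) _ _ fun τ => ?_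
  set m := Fintype.card I
  have hR0' : (0 : ℝ) < #R := by exact_mod_cast hR0
  by_cases h : d ≤ #(D τ)
  · have key := card_few_hits_fiber htop R τ (D τ) hI hR
    have hpos : 0 < (#(D τ) : ℝ) * #R := mul_pos (hd.trans_le h) hR0'
    have heq : #{σ : A → β | (∀ a ∉ R, σ a = τ a) ∧ d ≤ #(D σ) ∧
        4 * (m : ℝ) * #{p ∈ D σ | Hits top R σ p} < #(D σ) * #R} =
        #{σ : A → β | (∀ a ∉ R, σ a = τ a) ∧
          4 * (m : ℝ) * #{p ∈ D τ | Hits top R σ p} < #(D τ) * #R} := by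
      congr 1
      ext σ
      simp only [Finset.mem_filter, Finset.mem_univ, true_and]
      refine and_congr_right fun hσ => ?_
      rw [hD σ τ hσ]
      exact and_iff_right h
    rw [heq]
    rw [← le_div_iff₀ hpos] at key
    refine key.trans ?_
    rw [mul_div_right_comm]
    refine mul_le_mul_of_nonneg_right ?_ (Nat.cast_nonneg _)
    refine div_le_div_of_nonneg_left (by positivity) (mul_pos hd hR0') ?_
    exact mul_le_mul_of_nonneg_right h hR0'.le
  · have : ({σ : A → β | (∀ a ∉ R, σ a = τ a) ∧ d ≤ #(D σ) ∧
        4 * (m : ℝ) * #{p ∈ D σ | Hits top R σ p} < #(D σ) * #R} :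
          Finset (A → β)) = ∅ := by
      refine Finset.filter_eq_empty_iff.mpr fun σ _ hσ => h ?_
      rw [← hD σ τ hσ.1]; exact hσ.2.1
    rw [this]
    simp only [Finset.card_empty, Nat.cast_zero]
    positivity

omit [Fintype A] [Fintype β] [Fintype I] in
lemma hits_congr {R : Finset A} {σ τ : A → β} (h : ∀ a ∈ R, top (σ a) = top (τ a)) (p : I) :
    Hits top R σ p ↔ Hits top R τ p := by
  constructor
  · rintro ⟨a, ha, rfl⟩; exact ⟨a, ha, (h a ha).symm⟩
  · rintro ⟨a, ha, rfl⟩; exact ⟨a, ha, h a ha⟩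

omit [Fintype A] [Fintype β] in
lemma card_hit_le (R : Finset A) (σ : A → β) : #{p | Hits top R σ p} ≤ #R := by
  refine le_trans (Finset.card_le_card (t := R.image fun a => top (σ a)) fun p hp => ?_)
    Finset.card_image_le
  obtain ⟨a, ha, h⟩ := (Finset.mem_filter.mp hp).2
  exact Finset.mem_image.mpr ⟨a, ha, h⟩

/-- The first choices of members of `Y` that are not first choices of members of `X`. -/
def freshTops (top : β → I) (X Y : Finset A) (σ : A → β) : Finset I :=
  {p ∈ ({p | ¬ Hits top X σ p} : Finset I) | Hits top Y σ p}

omit [Fintype A] [Fintype β] in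
lemma exists_of_mem_freshTops {L R Y : Finset A} {σ : A → β} {p : I}
    (h : p ∈ freshTops top (L ∪ R) Y σ) :
    (∃ y ∈ Y, top (σ y) = p) ∧ ∀ a, a ∈ L ∨ a ∈ R → top (σ a) ≠ p := by
  simp only [freshTops, Finset.mem_filter, Finset.mem_univ, true_and] at h
  exact ⟨h.2, fun a ha hp => h.1 ⟨a, Finset.mem_union.mpr ha, hp⟩⟩

/-- The first choices common to `L` and `R`. -/
def commonTops (top : β → I) (L R : Finset A) (σ : A → β) : Finset I :=
  {p ∈ ({p | Hits top L σ p} : Finset I) | Hits top R σ p}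

/-- Some members of `L` and `R` share their first choice, and both have as second choice a first
choice of `Y` that is no first choice of `L ∪ R`. -/
def Conflict (top sec : β → I) (L R Y : Finset A) (σ : A → β) : Prop :=
  ∃ l ∈ L, ∃ r ∈ R, top (σ l) = top (σ r) ∧
    sec (σ l) ∈ freshTops top (L ∪ R) Y σ ∧ sec (σ r) ∈ freshTops top (L ∪ R) Y σ

variable {g : ℕ}

omit [Fintype I] in
lemma card_top_eq_sec_mem (hts : ∀ p q, p ≠ q → #{b | top b = p ∧ sec b = q} = g) {p : I}
    {G : Finset I} (hp : p ∉ G) : #{b | top b = p ∧ sec b ∈ G} = #G * g := by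
  rw [Finset.card_eq_sum_card_fiberwise (f := sec) (t := G)
    (fun a ha => (Finset.mem_filter.mp ha).2.2)]
  rw [Finset.sum_congr rfl (g := fun _ => g), Finset.sum_const, smul_eq_mul]
  intro q hq
  rw [← hts p q (fun h => hp (h ▸ hq))]
  congr 1
  ext b
  simp only [Finset.mem_filter, Finset.mem_univ, true_and]
  constructor
  · rintro ⟨⟨h, -⟩, h'⟩; exact ⟨h, h'⟩
  · rintro ⟨h, rfl⟩; exact ⟨⟨h, hq⟩, rfl⟩

lemma card_top_eq (hne : ∀ b, top b ≠ sec b)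
    (hts : ∀ p q, p ≠ q → #{b | top b = p ∧ sec b = q} = g) (p : I) :
    #{b | top b = p} = (Fintype.card I - 1) * g := by
  have h := card_top_eq_sec_mem hts (p := p) (G := {p}ᶜ) (by simp)
  rw [Finset.card_compl, Finset.card_singleton] at h
  rw [← h]
  congr 1
  ext b
  simp only [Finset.mem_filter, Finset.mem_univ, true_and, Finset.mem_compl, Finset.mem_singleton]
  constructor
  · rintro rfl; exact ⟨rfl, (hne b).symm⟩
  · exact And.left

lemma card_tops_fixed_sec_mem (hne : ∀ b, top b ≠ sec b)
    (hts : ∀ p q, p ≠ q → #{b | top b = p ∧ sec b = q} = g) (hI : 1 < Fintype.card I)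
    (τ : A → β) (G : Finset I) (S : Finset A) (hS : ∀ a ∈ S, top (τ a) ∉ G) :
    (#{σ : A → β | (∀ a, top (σ a) = top (τ a)) ∧ ∀ a ∈ S, sec (σ a) ∈ G} : ℝ) =
      (#G / ((Fintype.card I : ℝ) - 1)) ^ #S *
        #{σ : A → β | ∀ a, top (σ a) = top (τ a)} := by
  have key : ∀ S : Finset A, (∀ a ∈ S, top (τ a) ∉ G) →
      #{σ : A → β | (∀ a, top (σ a) = top (τ a)) ∧ ∀ a ∈ S, sec (σ a) ∈ G} =
        (#G * g) ^ #S * ((Fintype.card I - 1) * g) ^ #Sᶜ := by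
    intro S hS
    have : ({σ : A → β | (∀ a, top (σ a) = top (τ a)) ∧ ∀ a ∈ S, sec (σ a) ∈ G} :
        Finset (A → β)) = Fintype.piFinset fun a => if a ∈ S then
          ({b | top b = top (τ a) ∧ sec b ∈ G} : Finset β) else ({b | top b = top (τ a)} : Finset β) := by
      ext σ
      simp only [Finset.mem_filter, Finset.mem_univ, true_and, Fintype.mem_piFinset]
      constructor
      · rintro ⟨h1, h2⟩ a
        by_cases h : a ∈ S
        · simpa [h] using ⟨h1 a, h2 a h⟩
        · simpa [h] using h1 a
      · intro h
        refine ⟨fun a => ?_, fun a ha => ?_⟩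
        · by_cases ha : a ∈ S
          · have := h a; simp [ha] at this; exact this.1
          · simpa [ha] using h a
        · have := h a; simp [ha] at this; exact this.2
    rw [this, Fintype.card_piFinset]
    have h2 : ∀ a, #(if a ∈ S then ({b | top b = top (τ a) ∧ sec b ∈ G} : Finset β)
        else ({b | top b = top (τ a)} : Finset β)) =
        if a ∈ S then #G * g else (Fintype.card I - 1) * g := by
      intro a
      split_ifs with h
      · exact card_top_eq_sec_mem hts (hS a h)
      · exact card_top_eq hne hts _
    simp only [h2]
    rw [Finset.prod_ite]
    simp only [Finset.prod_const]
    congr 3 <;> ext a <;> simp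
  have hcard : 0 < (Fintype.card I : ℝ) - 1 := by
    rw [sub_pos]; exact_mod_cast hI
  have h0 := key ∅ (by simp)
  have hS' := key S hS
  have e0 : #{σ : A → β | ∀ a, top (σ a) = top (τ a)} =
      ((Fintype.card I - 1) * g) ^ (#S + #Sᶜ) := by
    rw [Finset.card_add_card_compl]
    simpa using h0
  rw [hS', e0, pow_add]
  push_cast [Nat.cast_sub hI.le]
  rw [← mul_assoc, ← mul_pow]
  congr 2
  field_simp

lemma card_no_conflict_fiber (hne : ∀ b, top b ≠ sec b)
    (hts : ∀ p q, p ≠ q → #{b | top b = p ∧ sec b = q} = g) (hI : 1 < Fintype.card I)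
    {L R Y : Finset A} (hLR : Disjoint L R) (τ : A → β) (d e : ℝ) (hd : 0 < d) (he : 0 < e)
    (hdτ : d ≤ #(commonTops top L R τ)) (heτ : e ≤ #(freshTops top (L ∪ R) Y τ)) :
    (#{σ : A → β | (∀ a, top (σ a) = top (τ a)) ∧ ¬ Conflict top sec L R Y σ} : ℝ) ≤
      4 * (Fintype.card I : ℝ) ^ 2 / (d * e ^ 2) *
        #{σ : A → β | ∀ a, top (σ a) = top (τ a)} := by
  set D := commonTops top L R τ with hD
  set G := freshTops top (L ∪ R) Y τ with hG
  set m := Fintype.card I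
  have hm1 : (0 : ℝ) < (m : ℝ) - 1 := by rw [sub_pos]; exact_mod_cast hI
  have hl : ∀ p ∈ D, ∃ l ∈ L, top (τ l) = p := fun p hp => by
    simp only [hD, commonTops, Finset.mem_filter] at hp; exact hp.1.2
  have hr : ∀ p ∈ D, ∃ r ∈ R, top (τ r) = p := fun p hp => by
    simp only [hD, commonTops, Finset.mem_filter] at hp; exact hp.2
  have hDG : ∀ p ∈ D, p ∉ G := fun p hp hpG => by
    obtain ⟨l, hlL, hlp⟩ := hl p hp
    simp only [hG, freshTops, Finset.mem_filter] at hpG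
    exact hpG.1.2 ⟨l, Finset.mem_union_left _ hlL, hlp⟩
  have : Nonempty A := by
    have hpos : 0 < #D := by exact_mod_cast hd.trans_le hdτ
    obtain ⟨p, hp⟩ := Finset.card_pos.mp hpos
    exact ⟨(hl p hp).choose⟩
  choose! l hlL hlt using hl
  choose! r hrR hrt using hr
  have hlr : ∀ p ∈ D, ∀ q ∈ D, l p ≠ r q := fun p hp q hq h =>
    Finset.disjoint_left.mp hLR (hlL p hp) (h ▸ hrR q hq)
  let Ω : Finset (A → β) := {σ | ∀ a, top (σ a) = top (τ a)}
  obtain ⟨E, hE⟩ : ∃ E : I → (A → β) → Prop,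
      ∀ p σ, E p σ ↔ ∀ a ∈ ({l p, r p} : Finset A), sec (σ a) ∈ G := ⟨_, fun _ _ => Iff.rfl⟩
  have hcount := fun S hS => card_tops_fixed_sec_mem hne hts hI τ G S hS
  set y : ℝ := #G / ((m : ℝ) - 1) with hy
  have hy0 : 0 ≤ y := div_nonneg (Nat.cast_nonneg _) hm1.le
  have hem : e / m ≤ y := by
    rw [hy]
    refine div_le_div₀ (Nat.cast_nonneg _) heτ hm1 (by linarith)
  have hm0 : (0 : ℝ) < m := by linarith
  have key := card_filter_few_events_mul_le Ω D E (y ^ 2) (sq_nonneg _)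
    (by
      intro p hp
      have := hcount {l p, r p} (by
        intro a ha
        simp only [Finset.mem_insert, Finset.mem_singleton] at ha
        rcases ha with rfl | rfl
        · rw [hlt p hp]; exact hDG p hp
        · rw [hrt p hp]; exact hDG p hp)
      rw [Finset.card_pair (hlr p hp p hp)] at this
      rw [← this]
      simp only [Ω, hE, Finset.filter_filter])
    (by
      intro p hp q hq hpq
      have hl' : l p ≠ l q := fun h => hpq (by rw [← hlt p hp, h, hlt q hq])
      have hr' : r p ≠ r q := fun h => hpq (by rw [← hrt p hp, h, hrt q hq])
      have hc : #({l p, r p, l q, r q} : Finset A) = 4 := by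
        have h1 := hlr p hp p hp
        have h2 := hlr p hp q hq
        have h3 := hlr q hq p hp
        have h4 := hlr q hq q hq
        rw [Finset.card_insert_of_notMem, Finset.card_insert_of_notMem,
          Finset.card_insert_of_notMem, Finset.card_singleton] <;>
        simp only [Finset.mem_insert, Finset.mem_singleton] <;> grind
      have := hcount {l p, r p, l q, r q} (by
        intro a ha
        simp only [Finset.mem_insert, Finset.mem_singleton] at ha
        rcases ha with rfl | rfl | rfl | rfl
        · rw [hlt p hp]; exact hDG p hp
        · rw [hrt p hp]; exact hDG p hp
        · rw [hlt q hq]; exact hDG q hq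
        · rw [hrt q hq]; exact hDG q hq)
      rw [hc] at this
      rw [← pow_mul, ← this]
      apply le_of_eq
      congr 2
      ext σ
      simp only [Ω, hE, Finset.mem_filter, Finset.mem_univ, true_and, Finset.mem_insert,
        Finset.mem_singleton, forall_eq_or_imp, forall_eq, and_assoc])
  have hpos : 0 < (#D : ℝ) * y ^ 2 := by
    have : 0 < y := lt_of_lt_of_le (by positivity) hem
    have : 0 < (#D : ℝ) := hd.trans_le hdτ
    positivity
  have hsub : #{σ : A → β | (∀ a, top (σ a) = top (τ a)) ∧ ¬ Conflict top sec L R Y σ} ≤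
      #{σ ∈ Ω | 2 * (#{p ∈ D | E p σ} : ℝ) < #D * y ^ 2} := by
    refine Finset.card_le_card fun σ hσ => ?_
    simp only [Ω, Finset.mem_filter, Finset.mem_univ, true_and] at hσ ⊢
    refine ⟨hσ.1, ?_⟩
    have hemp : ({p ∈ D | E p σ} : Finset I) = ∅ := by
      refine Finset.filter_eq_empty_iff.mpr fun p hp hEp => hσ.2 ?_
      have hGσ : freshTops top (L ∪ R) Y σ = G := by
        ext q
        simp only [hG, freshTops, Finset.mem_filter, Finset.mem_univ, true_and]
        rw [hits_congr (fun a _ => hσ.1 a), hits_congr (R := Y) (fun a _ => hσ.1 a)]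
      refine ⟨l p, hlL p hp, r p, hrR p hp, ?_, ?_, ?_⟩
      · rw [hσ.1, hσ.1, hlt p hp, hrt p hp]
      · rw [hGσ]; exact (hE p σ).mp hEp _ (by simp)
      · rw [hGσ]; exact (hE p σ).mp hEp _ (by simp)
    rw [hemp]
    simpa using hpos
  have hsub' : (#{σ : A → β | (∀ a, top (σ a) = top (τ a)) ∧ ¬ Conflict top sec L R Y σ} : ℝ) ≤
      #{σ ∈ Ω | 2 * (#{p ∈ D | E p σ} : ℝ) < #D * y ^ 2} := by exact_mod_cast hsub
  rw [← le_div_iff₀ hpos] at key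
  refine (hsub'.trans key).trans ?_
  rw [mul_div_right_comm]
  refine mul_le_mul_of_nonneg_right ?_ (Nat.cast_nonneg _)
  have hde : 4 * (m : ℝ) ^ 2 / (d * e ^ 2) = 4 / (d * (e / m) ^ 2) := by
    field_simp
  rw [hde]
  refine div_le_div_of_nonneg_left (by norm_num) (by positivity) ?_
  gcongr

lemma card_no_conflict_of_many (hne : ∀ b, top b ≠ sec b)
    (hts : ∀ p q, p ≠ q → #{b | top b = p ∧ sec b = q} = g) (hI : 1 < Fintype.card I)
    {L R Y : Finset A} (hLR : Disjoint L R) (d e : ℝ) (hd : 0 < d) (he : 0 < e) :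
    (#{σ : A → β | d ≤ #(commonTops top L R σ) ∧ e ≤ #(freshTops top (L ∪ R) Y σ) ∧
        ¬ Conflict top sec L R Y σ} : ℝ) ≤
      4 * (Fintype.card I : ℝ) ^ 2 / (d * e ^ 2) * Fintype.card (A → β) := by
  refine card_filter_le_of_fiberwise (fun (σ : A → β) a => top (σ a))
    (fun σ τ => ∀ a, top (σ a) = top (τ a)) (fun σ τ => by simp [funext_iff]) _ _ fun τ => ?_
  have hD : ∀ σ : A → β, (∀ a, top (σ a) = top (τ a)) →
      commonTops top L R σ = commonTops top L R τ := by
    intro σ hσ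
    ext q
    simp only [commonTops, Finset.mem_filter, Finset.mem_univ, true_and]
    rw [hits_congr (fun a _ => hσ a), hits_congr (R := R) (fun a _ => hσ a)]
  have hG : ∀ σ : A → β, (∀ a, top (σ a) = top (τ a)) →
      freshTops top (L ∪ R) Y σ = freshTops top (L ∪ R) Y τ := by
    intro σ hσ
    ext q
    simp only [freshTops, Finset.mem_filter, Finset.mem_univ, true_and]
    rw [hits_congr (fun a _ => hσ a), hits_congr (R := Y) (fun a _ => hσ a)]
  by_cases h : d ≤ #(commonTops top L R τ) ∧ e ≤ #(freshTops top (L ∪ R) Y τ)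
  · refine le_trans ?_ (card_no_conflict_fiber hne hts hI hLR τ d e hd he h.1 h.2)
    rw [Nat.cast_le]
    refine Finset.card_le_card fun σ hσ => ?_
    simp only [Finset.mem_filter, Finset.mem_univ, true_and] at hσ ⊢
    exact ⟨hσ.1, hσ.2.2.2⟩
  · have : #{σ : A → β | (∀ a, top (σ a) = top (τ a)) ∧ d ≤ #(commonTops top L R σ) ∧
        e ≤ #(freshTops top (L ∪ R) Y σ) ∧ ¬ Conflict top sec L R Y σ} = 0 := by
      refine Finset.card_eq_zero.mpr (Finset.filter_eq_empty_iff.mpr fun σ _ hσ => h ?_)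
      rw [← hD σ hσ.1, ← hG σ hσ.1]
      exact ⟨hσ.2.1, hσ.2.2.1⟩
    rw [this, Nat.cast_zero]
    positivity

lemma card_no_conflict (hne : ∀ b, top b ≠ sec b)
    (hts : ∀ p q, p ≠ q → #{b | top b = p ∧ sec b = q} = g) (hI : 1 < Fintype.card I)
    {L R Y : Finset A} (hLR : Disjoint L R) (hLY : Disjoint L Y) (hRY : Disjoint R Y)
    (hL0 : 0 < #L) (hR0 : 0 < #R) (hY0 : 0 < #Y) (hA : Fintype.card A ≤ Fintype.card I)
    {c : ℝ} (hc : 0 < c)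
    (hcA : (Fintype.card I : ℝ) / c ≤ (Fintype.card I : ℝ) - Fintype.card A) :
    (#{σ : A → β | ¬ Conflict top sec L R Y σ} : ℝ) ≤
      (8 / #L + 32 * Fintype.card I / (#L * #R) + 8 * c / #Y +
        1024 * c ^ 2 * Fintype.card I ^ 3 / (#L * #R * #Y ^ 2)) * Fintype.card (A → β) := by
  set m := Fintype.card I with hm
  have hI0 : 0 < Fintype.card I := by omega
  have hm0 : (0 : ℝ) < m := by exact_mod_cast hI0
  have hL0' : (0 : ℝ) < #L := by exact_mod_cast hL0
  have hR0' : (0 : ℝ) < #R := by exact_mod_cast hR0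
  have hY0' : (0 : ℝ) < #Y := by exact_mod_cast hY0
  have hLRY : Disjoint (L ∪ R) Y := Finset.disjoint_union_left.mpr ⟨hLY, hRY⟩
  have htop := card_top_eq hne hts
  have hle : ∀ S : Finset A, #S ≤ Fintype.card I := fun S => (Finset.card_le_univ S).trans hA
  have b₁ := card_few_hits htop L (fun _ => univ) (fun _ _ _ => rfl) hI0 hL0 (hle L) m hm0
  have b₂ := card_few_hits htop R (fun σ => {p | Hits top L σ p})
    (fun σ τ h => by
      ext p
      simp only [Finset.mem_filter, Finset.mem_univ, true_and]
      exact hits_congr (fun a ha => by rw [h a (Finset.disjoint_left.mp hLR ha)]) p)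
    hI0 hR0 (hle R) (#L / 4) (by positivity)
  have b₃ := card_few_hits htop Y (fun σ => {p | ¬ Hits top (L ∪ R) σ p})
    (fun σ τ h => by
      ext p
      simp only [Finset.mem_filter, Finset.mem_univ, true_and]
      exact not_congr
        (hits_congr (fun a ha => by rw [h a (Finset.disjoint_left.mp hLRY ha)]) p))
    hI0 hY0 (hle Y) (m / c) (by positivity)
  have b₄ := card_no_conflict_of_many (Y := Y) hne hts hI hLR (#L * #R / (16 * m)) (#Y / (4 * c))
    (by positivity) (by positivity)
  have hsub : (#{σ : A → β | ¬ Conflict top sec L R Y σ} : ℝ) ≤ _ + _ + _ + _ :=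
    le_trans ?_ (add_le_add (add_le_add (add_le_add b₁ b₂) b₃) b₄)
  · refine hsub.trans (le_of_eq ?_)
    rw [← hm]
    field_simp
    ring
  · rw [← Nat.cast_add, ← Nat.cast_add, ← Nat.cast_add, Nat.cast_le]
    refine le_trans (Finset.card_le_card fun σ hσ => ?_) ((Finset.card_union_le _ _).trans
      (Nat.add_le_add_right ((Finset.card_union_le _ _).trans
        (Nat.add_le_add_right (Finset.card_union_le _ _) _)) _))
    by_contra hcon
    replace hσ := (Finset.mem_filter.mp hσ).2
    simp only [Finset.mem_union, not_or] at hcon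
    obtain ⟨⟨⟨h₁, h₂⟩, h₃⟩, h₄⟩ := hcon
    replace h₁ := fun h => h₁ (Finset.mem_filter.mpr ⟨Finset.mem_univ _, h⟩)
    replace h₂ := fun h => h₂ (Finset.mem_filter.mpr ⟨Finset.mem_univ _, h⟩)
    replace h₃ := fun h => h₃ (Finset.mem_filter.mpr ⟨Finset.mem_univ _, h⟩)
    replace h₄ := fun h => h₄ (Finset.mem_filter.mpr ⟨Finset.mem_univ _, h⟩)
    replace h₁ := not_lt.mp (not_and.mp h₁ (by rw [Finset.card_univ]))
    rw [Finset.card_univ, ← hm] at h₁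
    have h₁' : (#L : ℝ) / 4 ≤ #{p | Hits top L σ p} := by
      have : (m : ℝ) * #L ≤ m * (4 * #{p | Hits top L σ p}) := by linarith
      linarith [le_of_mul_le_mul_left this hm0]
    have h₂' : (#L : ℝ) * #R / (16 * m) ≤ #(commonTops top L R σ) := by
      have := not_lt.mp (not_and.mp h₂ h₁')
      rw [div_le_iff₀ (by positivity)]
      have h := mul_le_mul_of_nonneg_right h₁' hR0'.le
      simp only [commonTops]
      linarith
    have hfree : (m : ℝ) / c ≤ #{p | ¬ Hits top (L ∪ R) σ p} := by
      have h := Finset.card_filter_add_card_filter_not (s := (univ : Finset I))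
        (fun p => Hits top (L ∪ R) σ p)
      have h' := (card_hit_le (top := top) (L ∪ R) σ).trans (Finset.card_le_univ _)
      rw [Finset.card_univ, ← hm] at h
      have h₅ : (#{p | Hits top (L ∪ R) σ p} : ℝ) + #{p | ¬ Hits top (L ∪ R) σ p} = m := by
        exact_mod_cast h
      have h₆ : (#{p | Hits top (L ∪ R) σ p} : ℝ) ≤ Fintype.card A := by exact_mod_cast h'
      linarith
    have h₃' : (#Y : ℝ) / (4 * c) ≤ #(freshTops top (L ∪ R) Y σ) := by
      have := not_lt.mp (not_and.mp h₃ hfree)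
      have h := mul_le_mul_of_nonneg_right hfree hY0'.le
      simp only [freshTops]
      have h₅ : (m : ℝ) * ((#Y : ℝ) / (4 * c)) ≤
          m * #{p ∈ ({p | ¬ Hits top (L ∪ R) σ p} : Finset I) | Hits top Y σ p} := by
        have e : (m : ℝ) * ((#Y : ℝ) / (4 * c)) = (m / c * #Y) / 4 := by field_simp
        rw [e]
        linarith
      exact le_of_mul_le_mul_left h₅ hm0
    exact h₄ ⟨h₂', h₃', hσ⟩

end Sampling

lemma exists_perm_map_pair {I : Type*} {p q p' q' : I} (h : p ≠ q) (h' : p' ≠ q') :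
    ∃ ρ : I ≃ I, ρ p = p' ∧ ρ q = q' := by
  refine ⟨(Equiv.swap p p').trans (Equiv.swap (Equiv.swap p p' q) q'), ?_, ?_⟩
  · rw [Equiv.trans_apply, Equiv.swap_apply_left]
    exact Equiv.swap_apply_of_ne_of_ne
      (fun e => h ((Equiv.swap p p').injective ((Equiv.swap_apply_left p p').trans e))) h'
  · simp

lemma card_perm_symm_eq {I : Type} [Fintype I] {u v p q p' q' : I} (h : p ≠ q) (h' : p' ≠ q') :
    #{π : I ≃ I | π.symm u = p ∧ π.symm v = q} =
      #{π : I ≃ I | π.symm u = p' ∧ π.symm v = q'} := by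
  obtain ⟨ρ, rfl, rfl⟩ := exists_perm_map_pair h h'
  refine Finset.card_equiv (Equiv.equivCongr ρ (Equiv.refl I)) fun π => ?_
  simp [Equiv.equivCongr]

lemma exists_split_category {K : ℕ} (sz : Fin K → ℕ) (i : Fin K) :
    ∃ L R : Finset ((i : Fin K) × Fin (sz i)), #L = sz i / 2 ∧ sz i / 2 ≤ #R ∧ Disjoint L R ∧
      ∀ a, a.1 = i ↔ a ∈ L ∨ a ∈ R := by
  let C : Finset ((i : Fin K) × Fin (sz i)) := univ.map (Function.Embedding.sigmaMk i)
  have hC : #C = sz i := by simp [C]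
  have hmem : ∀ a, a ∈ C ↔ a.1 = i := by
    rintro ⟨j, b⟩
    simp only [C, Finset.mem_map, Finset.mem_univ, true_and, Function.Embedding.sigmaMk_apply]
    constructor
    · rintro ⟨x, hx⟩; exact (congrArg Sigma.fst hx).symm
    · rintro rfl; exact ⟨b, rfl⟩
  obtain ⟨L, hLC, hL⟩ := Finset.exists_subset_card_eq (s := C) (n := sz i / 2) (by omega)
  refine ⟨L, C \ L, hL, ?_, Finset.disjoint_sdiff, fun a => ?_⟩
  · rw [Finset.card_sdiff_of_subset hLC]; omega
  · rw [← hmem, Finset.mem_sdiff]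
    by_cases h : a ∈ L
    · simp [h, hLC h]
    · simp [h]

lemma not_hasPopular_kInstOf {K : ℕ} {sz : Fin K → ℕ} {m : ℕ} {w : Fin K → ℝ}
    (h : (∑ i, sz i) < m ∧ StrictAnti w ∧ ∀ i, 0 < w i) {i₀ : Fin K}
    (hw : ∀ i, i ≠ i₀ → w i < w i₀) {u v : Fin m} (hu : (u : ℕ) = 0) (hv : (v : ℕ) = 1)
    {L R Y : Finset ((i : Fin K) × Fin (sz i))} (hLR : Disjoint L R)
    (hmem : ∀ a, a.1 = i₀ ↔ a ∈ L ∨ a ∈ R) {σ : ((i : Fin K) × Fin (sz i)) → (Fin m ≃ Fin m)}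
    (hσ : Conflict (fun π : Fin m ≃ Fin m => π.symm u) (fun π => π.symm v) L R Y σ) :
    ¬ (kInstOf K sz m w h σ).HasPopular := by
  obtain ⟨l, hl, r, hr, htop, hsl, hsr⟩ := hσ
  obtain ⟨⟨y₁, -, hy₁⟩, hn₁⟩ := exists_of_mem_freshTops hsl
  obtain ⟨⟨y₂, -, hy₂⟩, hn₂⟩ := exists_of_mem_freshTops hsr
  have hu' : ∀ a q, q ≠ (σ a).symm u → (σ a q : ℕ) ≠ 0 := fun a q hq e =>
    hq ((σ a).eq_symm_apply.mpr (Fin.ext (e.trans hu.symm)))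
  have hv' : ∀ a q, q ≠ (σ a).symm v → (σ a q : ℕ) ≠ 1 := fun a q hq e =>
    hq ((σ a).eq_symm_apply.mpr (Fin.ext (e.trans hv.symm)))
  refine KWPM.not_hasPopular_of_conflict (P := kInstOf K sz m w h σ) (i₀ := i₀) hw
    (top := fun a => (σ a).symm u) (sec := fun a => (σ a).symm v) ?_ ?_ (x₁ := l) (x₂ := r)
    (y₁ := y₁) (y₂ := y₂) (fun e => Finset.disjoint_left.mp hLR hl (e ▸ hr))
    ((hmem l).mpr (Or.inl hl)) ((hmem r).mpr (Or.inr hr)) htop hy₁.symm hy₂.symm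
    (fun a ha => hy₁ ▸ hn₁ a ((hmem a).mp ha)) (fun a ha => hy₂ ▸ hn₂ a ((hmem a).mp ha))
  · intro a q hq
    change ((σ a ((σ a).symm u) : Fin m) : ℕ) < (σ a q : ℕ)
    rw [Equiv.apply_symm_apply, hu]
    exact Nat.pos_of_ne_zero (hu' a q hq)
  · intro a q hq hq₂
    change ((σ a ((σ a).symm v) : Fin m) : ℕ) < (σ a q : ℕ)
    rw [Equiv.apply_symm_apply, hv]
    have := hu' a q hq
    have := hv' a q hq₂
    omega

lemma kmProb_le {K : ℕ} {sz : Fin K → ℕ} {m : ℕ} {w : Fin K → ℝ} {i₀ i₁ : Fin K} (hi : i₁ ≠ i₀)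
    (hw : ∀ i, i ≠ i₀ → w i < w i₀) {c s : ℝ} (hc : 0 < c) (hs : 0 < s)
    (hs₀ : s ≤ (sz i₀ / 2 : ℕ)) (hs₁ : s ≤ sz i₁)
    (hm : (m : ℝ) / c ≤ (m : ℝ) - ∑ i, (sz i : ℝ)) :
    kmProb K sz m w ≤ 8 / s + 32 * m / (s * s) + 8 * c / s +
      1024 * c ^ 2 * m ^ 3 / (s * s * s ^ 2) := by
  unfold kmProb
  split_ifs with h
  swap
  · positivity
  have hcardA : Fintype.card ((i : Fin K) × Fin (sz i)) = ∑ i, sz i := by simp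
  have hpos : 0 < sz i₀ / 2 := by
    have := hs.trans_le hs₀
    exact_mod_cast this
  have hm1 : 1 < m := by
    have : sz i₀ ≤ ∑ i, sz i := Finset.single_le_sum (fun _ _ => Nat.zero_le _) (mem_univ i₀)
    omega
  let u : Fin m := ⟨0, by omega⟩
  let v : Fin m := ⟨1, hm1⟩
  have huv : u ≠ v := by simp [u, v]
  obtain ⟨L, R, hL, hR, hLR, hmem⟩ := exists_split_category sz i₀
  let Y : Finset ((i : Fin K) × Fin (sz i)) := univ.map (Function.Embedding.sigmaMk i₁)
  have hY : #Y = sz i₁ := by simp [Y]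
  have hY₁ : ∀ a ∈ Y, a.1 ≠ i₀ := by
    intro a ha
    obtain ⟨x, -, rfl⟩ := Finset.mem_map.mp ha
    exact hi
  have hsL : s ≤ (#L : ℝ) := by rw [hL]; exact hs₀
  have hsR : s ≤ (#R : ℝ) := hs₀.trans (by exact_mod_cast hR)
  have hsY : s ≤ (#Y : ℝ) := by rw [hY]; exact hs₁
  have key : (#{σ : ((i : Fin K) × Fin (sz i)) → (Fin m ≃ Fin m) |
      ¬ Conflict (fun π : Fin m ≃ Fin m => π.symm u) (fun π => π.symm v) L R Y σ} : ℝ) ≤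
      (8 / #L + 32 * Fintype.card (Fin m) / (#L * #R) + 8 * c / #Y +
        1024 * c ^ 2 * Fintype.card (Fin m) ^ 3 / (#L * #R * #Y ^ 2)) *
        Fintype.card (((i : Fin K) × Fin (sz i)) → (Fin m ≃ Fin m)) := by
    convert card_no_conflict (A := (i : Fin K) × Fin (sz i)) (β := Fin m ≃ Fin m)
      (top := fun π => π.symm u) (sec := fun π => π.symm v) (L := L) (R := R) (Y := Y) (c := c)
      (g := #{π : Fin m ≃ Fin m | π.symm u = u ∧ π.symm v = v})
      (fun π h => huv (π.symm.injective h))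
      (fun p q hpq => by convert card_perm_symm_eq (u := u) (v := v) hpq huv)
      (by simpa using hm1) hLR
      (Finset.disjoint_left.mpr fun a ha hY => hY₁ a hY ((hmem a).mpr (Or.inl ha)))
      (Finset.disjoint_left.mpr fun a ha hY => hY₁ a hY ((hmem a).mpr (Or.inr ha)))
      (by omega) (by omega) (by exact_mod_cast hs.trans_le hsY)
      (by rw [hcardA, Fintype.card_fin]; exact h.1.le) hc
      (by rw [hcardA, Fintype.card_fin]; push_cast; exact hm)
  rw [Fintype.card_fin] at key
  have hcard0 : (0 : ℝ) < Fintype.card (((i : Fin K) × Fin (sz i)) → (Fin m ≃ Fin m)) := by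
    exact_mod_cast Fintype.card_pos
  rw [div_le_iff₀ hcard0]
  have hsub : #{σ : ((i : Fin K) × Fin (sz i)) → (Fin m ≃ Fin m) |
      (kInstOf K sz m w h σ).HasPopular} ≤
      #{σ | ¬ Conflict (fun π : Fin m ≃ Fin m => π.symm u) (fun π => π.symm v) L R Y σ} :=
    Finset.card_le_card fun σ hσ => Finset.mem_filter.mpr ⟨Finset.mem_univ _, fun hcon =>
      not_hasPopular_kInstOf h hw rfl rfl hLR hmem hcon (Finset.mem_filter.mp hσ).2⟩
  refine (Nat.cast_le.mpr hsub).trans (key.trans ?_)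
  refine mul_le_mul_of_nonneg_right ?_ hcard0.le
  gcongr

lemma tendsto_error_bound {m : ℕ → ℕ} (c κ : ℝ)
    (hlim : Filter.Tendsto (fun n : ℕ => (m n : ℝ) / (n : ℝ) ^ ((4 : ℝ) / 3))
      Filter.atTop (nhds 0)) :
    Filter.Tendsto (fun n : ℕ => (8 + 8 * c) / κ * (n : ℝ)⁻¹ +
      32 / κ ^ 2 * ((m n : ℝ) / (n : ℝ) ^ ((4 : ℝ) / 3)) +
      1024 * c ^ 2 / κ ^ 4 * ((m n : ℝ) / (n : ℝ) ^ ((4 : ℝ) / 3)) ^ 3) Filter.atTop (nhds 0) := by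
  have h := ((tendsto_inv_atTop_nhds_zero_nat (𝕜 := ℝ)).const_mul ((8 + 8 * c) / κ)).add
    (hlim.const_mul (32 / κ ^ 2)) |>.add ((hlim.pow 3).const_mul (1024 * c ^ 2 / κ ^ 4))
  simpa using h

/-- **Theorem 6.** Fix `K > 2`, positive `δ i` summing to `1`, `c > 1`,
and strictly decreasing positive weights with `w i ≥ 2 w (i+1)`. If `m(n) - n ≥ m(n)/c`
for all `n` and `m(n)/n^{4/3} → 0`, then the probability that a random instance of the
complete and strict K-weighted popular matching problem with category sizes
`sz i = δ i · n` and `m(n)` items has a K-weighted popular matching tends to `0`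
(along those `n` for which every `δ i · n` is an integer). -/
theorem random_k_weighted_popular_lower_bound
    (K : ℕ) (hK : 2 < K)
    (δ : Fin K → ℝ) (hδ : ∀ i, 0 < δ i) (hδsum : ∑ i, δ i = 1)
    (c : ℝ) (hc : 1 < c)
    (w : Fin K → ℝ) (hwpos : ∀ i, 0 < w i) (hwanti : StrictAnti w)
    (hw2 : ∀ i j : Fin K, (j : ℕ) = (i : ℕ) + 1 → 2 * w j ≤ w i)
    (m : ℕ → ℕ) (hmc : ∀ n : ℕ, (m n : ℝ) / c ≤ (m n : ℝ) - (n : ℝ))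
    (hlim : Filter.Tendsto (fun n : ℕ => (m n : ℝ) / (n : ℝ) ^ ((4 : ℝ) / 3))
      Filter.atTop (nhds 0)) :
    ∀ ε : ℝ, 0 < ε → ∃ N : ℕ, ∀ n : ℕ, N ≤ n → ∀ sz : Fin K → ℕ,
      (∀ i, (sz i : ℝ) = δ i * n) → kmProb K sz (m n) w ≤ ε := by
  have hK0 : 0 < K := by omega
  let i₀ : Fin K := ⟨0, hK0⟩
  let i₁ : Fin K := ⟨1, by omega⟩
  have hi : i₁ ≠ i₀ := by simp [i₀, i₁]
  have hw : ∀ i, i ≠ i₀ → w i < w i₀ := fun i hi => hwanti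
    (lt_of_le_of_ne (Fin.mk_le_of_le_val (Nat.zero_le _)) hi.symm)
  set κ : ℝ := min (δ i₀ / 4) (δ i₁) with hκ
  have hκ0 : 0 < κ := lt_min (by linarith [hδ i₀]) (hδ i₁)
  have hc0 : 0 < c := by linarith
  intro ε hε
  obtain ⟨N, hN⟩ := Filter.eventually_atTop.mp
    ((tendsto_error_bound c κ hlim).eventually_le_const hε)
  refine ⟨max N (max 1 ⌈2 / δ i₀⌉₊), fun n hn sz hsz => ?_⟩
  have hnN : N ≤ n := (le_max_left _ _).trans hn
  have hn1 : 1 ≤ n := ((le_max_left _ _).trans (le_max_right _ _)).trans hn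
  have hn1' : (1 : ℝ) ≤ n := by exact_mod_cast hn1
  have hn0 : (0 : ℝ) < n := by linarith
  have hn2 : 2 ≤ δ i₀ * n := by
    have : (⌈2 / δ i₀⌉₊ : ℝ) ≤ n := by
      exact_mod_cast ((le_max_right _ _).trans (le_max_right _ _)).trans hn
    have := (Nat.le_ceil _).trans this
    rw [div_le_iff₀ (hδ i₀)] at this
    linarith
  have hsum : ∑ i, (sz i : ℝ) = n := by
    simp only [hsz, ← Finset.sum_mul, hδsum, one_mul]
  have hs₀ : κ * n ≤ (sz i₀ / 2 : ℕ) := by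
    have h1 : κ * n ≤ δ i₀ / 4 * n := mul_le_mul_of_nonneg_right (min_le_left _ _) hn0.le
    have h2 : (sz i₀ : ℝ) ≤ 2 * (sz i₀ / 2 : ℕ) + 1 := by
      have : sz i₀ ≤ 2 * (sz i₀ / 2) + 1 := by omega
      exact_mod_cast this
    rw [hsz i₀] at h2
    linarith
  have hs₁ : κ * n ≤ sz i₁ := by
    rw [hsz i₁]
    exact mul_le_mul_of_nonneg_right (min_le_right _ _) hn0.le
  have hprob := kmProb_le hi hw hc0 (mul_pos hκ0 hn0) hs₀ hs₁ (m := m n) (by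
    rw [hsum]; exact hmc n)
  refine hprob.trans (le_trans ?_ (hN n hnN))
  set p : ℝ := (n : ℝ) ^ ((4 : ℝ) / 3) with hp
  have hp0 : 0 < p := Real.rpow_pos_of_pos hn0 _
  have hp3 : p ^ 3 = (n : ℝ) ^ 4 := by
    rw [hp, ← Real.rpow_natCast, ← Real.rpow_mul hn0.le, ← Real.rpow_natCast]
    norm_num
  have hp2 : p ≤ (n : ℝ) ^ 2 := by
    rw [hp, ← Real.rpow_natCast]
    exact Real.rpow_le_rpow_of_exponent_le hn1' (by norm_num)
  have e₁ : 8 / (κ * n) + 8 * c / (κ * n) = (8 + 8 * c) / κ * (n : ℝ)⁻¹ := by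
    field_simp
  have e₂ : 32 * (m n : ℝ) / (κ * n * (κ * n)) ≤ 32 / κ ^ 2 * ((m n : ℝ) / p) := by
    have : 32 * (m n : ℝ) / (κ * n * (κ * n)) = 32 / κ ^ 2 * ((m n : ℝ) / (n : ℝ) ^ 2) := by
      field_simp
    rw [this]
    gcongr
  have e₃ : 1024 * c ^ 2 * (m n : ℝ) ^ 3 / (κ * n * (κ * n) * (κ * n) ^ 2) =
      1024 * c ^ 2 / κ ^ 4 * ((m n : ℝ) / p) ^ 3 := by
    rw [div_pow, hp3]
    field_simp
  linarith
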